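/- Let n ≥ 1, let T ⊆ [-1,1), let C be an (N,n,T) spherical code, and let F : [-1,1]³ → ℝ be a symmetric function. Suppose g : T → ℝ, p : T → ℝ and q : [-1,1] → ℝ are such that (1) F(1,t,t) ≤ p(t) − q(t) for all t ∈ T, and (2) F(t,u,v) ≤ g(t) + g(u) + g(v) for all (t,u,v) ∈ D₃(T). If S_F(C) ≥ F₀·N³ for some F₀ ∈ ℝ and S_q(C) ≥ 0, then N·F(1,1,1) + 3N·q(1) + 3·E_p(C) + (3N−6)·E_g(C) ≥ F₀·N³. -/

import Mathlib

open Finset RealInnerProductSpace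

/-- A triple sum splits according to which of the three indices coincide. -/
theorem Finset.sum_triple_eq_add_sum_erase {α M : Type*} [DecidableEq α] [AddCommMonoid M]
    (s : Finset α) (f : α → α → α → M) :
    ∑ x ∈ s, ∑ y ∈ s, ∑ z ∈ s, f x y z =
      ∑ x ∈ s, f x x x + ∑ x ∈ s, ∑ y ∈ s.erase x, (f x x y + f x y x + f x y y)
        + ∑ x ∈ s, ∑ y ∈ s.erase x, ∑ z ∈ (s.erase x).erase y, f x y z := by
  simp only [← sum_add_distrib]
  refine sum_congr rfl fun x hx => ?_
  rw [← add_sum_erase s _ hx, ← add_sum_erase s (f x x) hx, add_assoc, add_assoc]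
  simp only [sum_add_distrib, add_assoc]
  congr 2
  simp only [← sum_add_distrib]
  refine sum_congr rfl fun y hy => ?_
  rw [← add_sum_erase s _ hx, ← add_sum_erase (s.erase x) _ hy]

/-- Summing a symmetric function of pairs over the three pairs of each triple of distinct elements
counts each ordered pair `3 * #s - 6` times. -/
theorem Finset.sum_distinct_triple_of_symm {α R : Type*} [DecidableEq α] [CommRing R]
    (s : Finset α) (h : α → α → R) (hsymm : ∀ x y, h x y = h y x) :
    ∑ x ∈ s, ∑ y ∈ s.erase x, ∑ z ∈ (s.erase x).erase y, (h x y + h x z + h y z) =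
      (3 * (#s : R) - 6) * ∑ x ∈ s, ∑ y ∈ s.erase x, h x y := by
  set k : α → α → R := fun x y => if x = y then 0 else h x y with hk
  have hkk : ∀ x, k x x = 0 := fun x => by simp [hk]
  have hks : ∀ x y, k y x = k x y := fun x y => by
    simp only [hk, hsymm y x, eq_comm (a := y)]
  have hkh : ∀ x y, x ≠ y → k x y = h x y := fun x y hxy => by simp [hk, hxy]
  have hpairs : ∑ x ∈ s, ∑ y ∈ s.erase x, h x y = ∑ x ∈ s, ∑ y ∈ s, k x y := by
    refine sum_congr rfl fun x hx => ?_
    rw [← add_sum_erase s _ hx, hkk, zero_add]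
    exact sum_congr rfl fun y hy => (hkh x y (ne_of_mem_erase hy).symm).symm
  have htriples : ∑ x ∈ s, ∑ y ∈ s.erase x, ∑ z ∈ (s.erase x).erase y, (h x y + h x z + h y z) =
      ∑ x ∈ s, ∑ y ∈ s.erase x, ∑ z ∈ (s.erase x).erase y, (k x y + k x z + k y z) := by
    refine sum_congr rfl fun x _ => sum_congr rfl fun y hy => sum_congr rfl fun z hz => ?_
    rw [hkh x y (ne_of_mem_erase hy).symm, hkh y z (ne_of_mem_erase hz).symm,
      hkh x z (ne_of_mem_erase (mem_of_mem_erase hz)).symm]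
  have hdiag : ∑ x ∈ s, ∑ y ∈ s.erase x, k x y = ∑ x ∈ s, ∑ y ∈ s, k x y :=
    sum_congr rfl fun x _ => sum_erase s (hkk x)
  have hsplit := sum_triple_eq_add_sum_erase s fun x y z => k x y + k x z + k y z
  simp only [hkk, add_zero, zero_add, sum_const_zero] at hsplit
  rw [htriples, hpairs]
  have hdouble : ∑ x ∈ s, ∑ y ∈ s.erase x,
      (k x y + k x y + (k x y + k y x) + (k x y + k x y)) =
        6 * ∑ x ∈ s, ∑ y ∈ s, k x y := by
    rw [← hdiag, mul_sum]
    refine sum_congr rfl fun x _ => ?_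
    rw [mul_sum]
    refine sum_congr rfl fun y _ => ?_
    rw [hks x y]
    ring
  have hfull : ∑ x ∈ s, ∑ y ∈ s, ∑ z ∈ s, (k x y + k x z + k y z) =
      3 * (#s : R) * ∑ x ∈ s, ∑ y ∈ s, k x y := by
    simp only [sum_add_distrib, sum_const, nsmul_eq_mul, ← mul_sum]
    ring
  rw [hdouble, hfull] at hsplit
  rw [sub_mul, hsplit, add_sub_cancel_left]

/-- The Gram determinant of three unit vectors is nonnegative. -/
theorem gram_det_nonneg_of_norm_eq_one {E : Type*} [NormedAddCommGroup E] [InnerProductSpace ℝ E]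
    {x y z : E} (hx : ‖x‖ = 1) (hy : ‖y‖ = 1) (hz : ‖z‖ = 1) :
    0 ≤ 1 + 2 * ⟪x, y⟫ * ⟪x, z⟫ * ⟪y, z⟫ - ⟪x, y⟫ ^ 2 - ⟪x, z⟫ ^ 2 - ⟪y, z⟫ ^ 2 := by
  have hcs := real_inner_mul_inner_self_le (y - ⟪x, y⟫ • x) (z - ⟪x, z⟫ • x)
  simp only [inner_sub_left, inner_sub_right, real_inner_smul_left, real_inner_smul_right,
    real_inner_self_eq_norm_sq, norm_smul, mul_pow, Real.norm_eq_abs, sq_abs, hx, hy, hz,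
    real_inner_comm x y, real_inner_comm x z] at hcs
  linarith

open scoped Classical in
/-- Corollary cor3p: 3-point bound with `f = p - q` and `S_q(C) ≥ 0`. -/
theorem three_point_bound_with_q
    (n N : ℕ) (hn : 1 ≤ n) (T : Set ℝ) (hTsub : T ⊆ Set.Ico (-1 : ℝ) 1)
    (C : Finset (EuclideanSpace ℝ (Fin n))) (hcard : C.card = N)
    (hunit : ∀ x ∈ C, ‖x‖ = 1)
    (hcode : ∀ x ∈ C, ∀ y ∈ C, x ≠ y → ⟪x, y⟫ ∈ T)
    (F : ℝ → ℝ → ℝ → ℝ)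
    (hsym1 : ∀ a b c : ℝ, F a b c = F b a c)
    (hsym2 : ∀ a b c : ℝ, F a b c = F a c b)
    (g p q : ℝ → ℝ) (F₀ : ℝ)
    (h1 : ∀ t ∈ T, F 1 t t ≤ p t - q t)
    (h2 : ∀ t ∈ T, ∀ u ∈ T, ∀ v ∈ T,
      0 ≤ 1 + 2 * t * u * v - t ^ 2 - u ^ 2 - v ^ 2 →
        F t u v ≤ g t + g u + g v)
    (hSF : F₀ * (N : ℝ) ^ 3 ≤ ∑ x ∈ C, ∑ y ∈ C, ∑ z ∈ C, F ⟪x, y⟫ ⟪x, z⟫ ⟪y, z⟫)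
    (hSq : 0 ≤ ∑ x ∈ C, ∑ y ∈ C, q ⟪x, y⟫) :
    F₀ * (N : ℝ) ^ 3 ≤
      (N : ℝ) * F 1 1 1 + 3 * (N : ℝ) * q 1
        + 3 * ∑ x ∈ C, ∑ y ∈ C.erase x, p ⟪x, y⟫
        + (3 * (N : ℝ) - 6) * ∑ x ∈ C, ∑ y ∈ C.erase x, g ⟪x, y⟫ := by
  have hself : ∀ x ∈ C, ⟪x, x⟫ = 1 := fun x hx => by
    rw [real_inner_self_eq_norm_sq, hunit x hx, one_pow]
  have hmem : ∀ x ∈ C, ∀ y ∈ C.erase x, ⟪x, y⟫ ∈ T := fun x hx y hy =>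
    hcode x hx y (mem_of_mem_erase hy) (ne_of_mem_erase hy).symm
  have hdiag : ∑ x ∈ C, F ⟪x, x⟫ ⟪x, x⟫ ⟪x, x⟫ = (N : ℝ) * F 1 1 1 := by
    rw [sum_congr rfl fun x hx => by rw [hself x hx], sum_const, hcard, nsmul_eq_mul]
  have hpairs : ∑ x ∈ C, ∑ y ∈ C.erase x, (F ⟪x, x⟫ ⟪x, y⟫ ⟪x, y⟫ + F ⟪x, y⟫ ⟪x, x⟫ ⟪y, x⟫
      + F ⟪x, y⟫ ⟪x, y⟫ ⟪y, y⟫) ≤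
        3 * ∑ x ∈ C, ∑ y ∈ C.erase x, p ⟪x, y⟫ - 3 * ∑ x ∈ C, ∑ y ∈ C.erase x, q ⟪x, y⟫ := by
    simp only [mul_sum, ← sum_sub_distrib]
    refine sum_le_sum fun x hx => sum_le_sum fun y hy => ?_
    rw [hself x hx, hself y (mem_of_mem_erase hy), real_inner_comm x y, hsym1 ⟪x, y⟫ 1,
      hsym2 ⟪x, y⟫ ⟪x, y⟫ 1, hsym1 ⟪x, y⟫ 1]
    linarith [h1 _ (hmem x hx y hy)]
  have hq : ∑ x ∈ C, ∑ y ∈ C, q ⟪x, y⟫ =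
      (N : ℝ) * q 1 + ∑ x ∈ C, ∑ y ∈ C.erase x, q ⟪x, y⟫ := by
    rw [← hcard, ← nsmul_eq_mul, ← sum_const, ← sum_add_distrib]
    refine sum_congr rfl fun x hx => ?_
    rw [← add_sum_erase C _ hx, hself x hx]
  have htriples : ∑ x ∈ C, ∑ y ∈ C.erase x, ∑ z ∈ (C.erase x).erase y,
      F ⟪x, y⟫ ⟪x, z⟫ ⟪y, z⟫ ≤
        (3 * (N : ℝ) - 6) * ∑ x ∈ C, ∑ y ∈ C.erase x, g ⟪x, y⟫ := by
    rw [← hcard, ← sum_distinct_triple_of_symm C (fun x y => g ⟪x, y⟫)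
      fun x y => by rw [real_inner_comm]]
    refine sum_le_sum fun x hx => sum_le_sum fun y hy => sum_le_sum fun z hz => ?_
    have hy' := mem_of_mem_erase hy
    have hzx := mem_of_mem_erase hz
    have hz' := mem_of_mem_erase hzx
    exact h2 _ (hmem x hx y hy) _ (hmem x hx z hzx) _
      (hcode y hy' z hz' (ne_of_mem_erase hz).symm)
      (gram_det_nonneg_of_norm_eq_one (hunit x hx) (hunit y hy') (hunit z hz'))
  rw [sum_triple_eq_add_sum_erase] at hSF
  linarith
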